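/- arXiv:2309.04984 — 6 statements merged into one kernel-verified Lean document; each statement's English description precedes it below -/
import Mathlib

section
/- For each n, let m_n ≥ 1 and let C₁⁽ⁿ⁾ < C₂⁽ⁿ⁾ < ⋯ < C_{m_n}⁽ⁿ⁾ be thresholds in ℝ with the conventions C₀⁽ⁿ⁾ = −∞ and C_{m_n+1}⁽ⁿ⁾ = +∞, and define H_i⁽ⁿ⁾ and h_i⁽ⁿ⁾ from these thresholds. Suppose C₁⁽ⁿ⁾ → −∞, C_{m_n}⁽ⁿ⁾ → +∞, and max_{2 ≤ i ≤ m_n} (C_i⁽ⁿ⁾ − C_{i−1}⁽ⁿ⁾) → 0 as n → ∞. Then for every x ∈ ℝ, ρ⁽ⁿ⁾(x) := Σ_{i=1}^{m_n+1} (h_i⁽ⁿ⁾(x))² / H_i⁽ⁿ⁾(x) converges to 1/σ² as n → ∞. -/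
set_option autoImplicit false

open MeasureTheory ProbabilityTheory Filter Finset Matrix

/-- The density of the Gaussian distribution `N(0, σ²)`. -/
noncomputable def gaussPdf (σ x : ℝ) : ℝ :=
  (σ * Real.sqrt (2 * Real.pi))⁻¹ * Real.exp (-(x ^ 2) / (2 * σ ^ 2))

/-- The cumulative distribution function of the Gaussian distribution `N(0, σ²)`. -/
noncomputable def gaussCdf (σ x : ℝ) : ℝ := ∫ t in Set.Iic x, gaussPdf σ t

/-- `H i x = F(Cᵢ - x) - F(Cᵢ₋₁ - x)` for `i = 1, …, m+1`, with the conventions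
`C₀ = -∞`, `C_{m+1} = +∞` (so `F(C₀ - x) = 0` and `F(C_{m+1} - x) = 1`). -/
noncomputable def Hfun (σ : ℝ) (m : ℕ) (C : ℕ → ℝ) (i : ℕ) (x : ℝ) : ℝ :=
  if i = 1 then gaussCdf σ (C 1 - x)
  else if i = m + 1 then 1 - gaussCdf σ (C m - x)
  else gaussCdf σ (C i - x) - gaussCdf σ (C (i - 1) - x)

/-- `h i x = f(Cᵢ - x) - f(Cᵢ₋₁ - x)` for `i = 1, …, m+1`, with the conventions
`C₀ = -∞`, `C_{m+1} = +∞` (so `f(C₀ - x) = f(C_{m+1} - x) = 0`). -/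
noncomputable def hfun (σ : ℝ) (m : ℕ) (C : ℕ → ℝ) (i : ℕ) (x : ℝ) : ℝ :=
  if i = 1 then gaussPdf σ (C 1 - x)
  else if i = m + 1 then -gaussPdf σ (C m - x)
  else gaussPdf σ (C i - x) - gaussPdf σ (C (i - 1) - x)


lemma gaussPdf_eq {σ : ℝ} (hσ : 0 < σ) (x : ℝ) :
    gaussPdf σ x = gaussianPDFReal 0 (Real.toNNReal (σ ^ 2)) x := by
  unfold gaussPdf gaussianPDFReal
  rw [Real.coe_toNNReal _ (sq_nonneg σ), Real.sqrt_mul (x := 2 * Real.pi) (by positivity) (σ ^ 2), Real.sqrt_sq hσ.le,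
    sub_zero, mul_comm σ]

lemma gaussPdf_pos {σ : ℝ} (hσ : 0 < σ) (x : ℝ) : 0 < gaussPdf σ x := by
  unfold gaussPdf
  positivity

lemma gaussPdf_int0 {σ : ℝ} (hσ : 0 < σ) : Integrable (fun t => gaussPdf σ t) := by
  simp_rw [gaussPdf_eq hσ]
  exact integrable_gaussianPDFReal _ _

lemma gaussPdf_alt (σ x : ℝ) : gaussPdf σ x =
    (σ * Real.sqrt (2 * Real.pi))⁻¹ * Real.exp (-(1 / (2 * σ ^ 2)) * x ^ 2) := by
  unfold gaussPdf
  congr 2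
  ring

lemma gaussPdf_int1 {σ : ℝ} (hσ : 0 < σ) : Integrable (fun t => t * gaussPdf σ t) := by
  simp_rw [gaussPdf_alt]
  have h := (integrable_mul_exp_neg_mul_sq (b := 1 / (2 * σ ^ 2)) (by positivity)).const_mul
    ((σ * Real.sqrt (2 * Real.pi))⁻¹)
  refine h.congr (ae_of_all _ fun t => ?_)
  simp only
  ring

lemma gaussPdf_int2 {σ : ℝ} (hσ : 0 < σ) : Integrable (fun t => t ^ 2 * gaussPdf σ t) := by
  simp_rw [gaussPdf_alt]
  have h := (integrable_rpow_mul_exp_neg_mul_sq (b := 1 / (2 * σ ^ 2)) (by positivity)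
    (s := 2) (by norm_num)).const_mul ((σ * Real.sqrt (2 * Real.pi))⁻¹)
  refine h.congr (ae_of_all _ fun t => ?_)
  simp only [Real.rpow_two]
  ring

lemma gaussPdf_total0 {σ : ℝ} (hσ : 0 < σ) : ∫ t, gaussPdf σ t = 1 := by
  simp_rw [gaussPdf_eq hσ]
  exact integral_gaussianPDFReal_eq_one _ (by simp; positivity)

lemma gaussPdf_total2 {σ : ℝ} (hσ : 0 < σ) : ∫ t, t ^ 2 * gaussPdf σ t = σ ^ 2 := by
  have hv : Real.toNNReal (σ ^ 2) ≠ 0 := by simp; positivity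
  have h := variance_of_integral_eq_zero (X := fun x : ℝ => x)
    (μ := gaussianReal 0 (Real.toNNReal (σ ^ 2))) (by fun_prop) integral_id_gaussianReal
  rw [variance_fun_id_gaussianReal, integral_gaussianReal_eq_integral_smul hv,
    Real.coe_toNNReal _ (sq_nonneg σ)] at h
  rw [h]
  congr 1 with t
  rw [gaussPdf_eq hσ, smul_eq_mul, mul_comm]

lemma gaussPdf_deriv {σ : ℝ} (hσ : 0 < σ) (x : ℝ) :
    HasDerivAt (fun t => -σ ^ 2 * gaussPdf σ t) (x * gaussPdf σ x) x := by
  unfold gaussPdf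
  have h1 : HasDerivAt (fun t : ℝ => -(t ^ 2) / (2 * σ ^ 2)) (-(2 * x) / (2 * σ ^ 2)) x := by
    have := ((hasDerivAt_pow 2 x).neg).div_const (2 * σ ^ 2)
    simpa using this
  have h2 := (h1.exp.const_mul ((σ * Real.sqrt (2 * Real.pi))⁻¹)).const_mul (-σ ^ 2)
  refine h2.congr_deriv ?_
  have : σ ≠ 0 := hσ.ne'
  have : Real.sqrt (2 * Real.pi) ≠ 0 := by positivity
  field_simp

lemma first_Iic {σ : ℝ} (hσ : 0 < σ) (a : ℝ) :
    ∫ t in Set.Iic a, t * gaussPdf σ t = -σ ^ 2 * gaussPdf σ a := by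
  have h0 := tendsto_zero_of_hasDerivAt_of_integrableOn_Iic (a := a)
    (fun x _ => gaussPdf_deriv hσ x) (gaussPdf_int1 hσ).integrableOn
    ((gaussPdf_int0 hσ).const_mul (-σ ^ 2)).integrableOn
  have := integral_Iic_of_hasDerivAt_of_tendsto' (a := a)
    (fun x _ => gaussPdf_deriv hσ x) (gaussPdf_int1 hσ).integrableOn h0
  simpa using this

lemma first_Ioi {σ : ℝ} (hσ : 0 < σ) (a : ℝ) :
    ∫ t in Set.Ioi a, t * gaussPdf σ t = σ ^ 2 * gaussPdf σ a := by
  have h0 := tendsto_zero_of_hasDerivAt_of_integrableOn_Ioi (a := a)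
    (fun x _ => gaussPdf_deriv hσ x) (gaussPdf_int1 hσ).integrableOn
    ((gaussPdf_int0 hσ).const_mul (-σ ^ 2)).integrableOn
  have := integral_Ioi_of_hasDerivAt_of_tendsto' (a := a)
    (fun x _ => gaussPdf_deriv hσ x) (gaussPdf_int1 hσ).integrableOn h0
  simpa using this

lemma set_Ioc {g : ℝ → ℝ} (hg : Integrable g) {a b : ℝ} (hab : a ≤ b) :
    ∫ t in Set.Ioc a b, g t = (∫ t in Set.Iic b, g t) - ∫ t in Set.Iic a, g t := by
  rw [intervalIntegral.integral_Iic_sub_Iic hg.integrableOn hg.integrableOn,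
    intervalIntegral.integral_of_le hab]

lemma set_Ioi {g : ℝ → ℝ} (hg : Integrable g) (a : ℝ) :
    ∫ t in Set.Ioi a, g t = (∫ t, g t) - ∫ t in Set.Iic a, g t := by
  have := intervalIntegral.integral_Iic_add_Ioi (b := a) hg.integrableOn hg.integrableOn
  linarith

lemma quad {σ : ℝ} (hσ : 0 < σ) (s : Set ℝ) (c : ℝ) :
    ∫ t in s, (t - c) ^ 2 * gaussPdf σ t =
      (∫ t in s, t ^ 2 * gaussPdf σ t) - 2 * c * (∫ t in s, t * gaussPdf σ t)
        + c ^ 2 * ∫ t in s, gaussPdf σ t := by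
  rw [← integral_const_mul, ← integral_const_mul, ← integral_sub, ← integral_add]
  · congr 1 with t
    ring
  · exact ((gaussPdf_int2 hσ).sub ((gaussPdf_int1 hσ).const_mul (2 * c))).integrableOn
  · exact ((gaussPdf_int0 hσ).const_mul (c ^ 2)).integrableOn
  · exact (gaussPdf_int2 hσ).integrableOn
  · exact ((gaussPdf_int1 hσ).const_mul (2 * c)).integrableOn

lemma second_nonneg {σ : ℝ} (hσ : 0 < σ) (s : Set ℝ) (c : ℝ) :
    0 ≤ ∫ t in s, (t - c) ^ 2 * gaussPdf σ t :=
  integral_nonneg fun t => mul_nonneg (sq_nonneg _) (gaussPdf_pos hσ t).le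

lemma zeroth_nonneg {σ : ℝ} (hσ : 0 < σ) (s : Set ℝ) : 0 ≤ ∫ t in s, gaussPdf σ t :=
  integral_nonneg fun t => (gaussPdf_pos hσ t).le

lemma cell_upper {σ : ℝ} (hσ : 0 < σ) (s : Set ℝ) :
    (∫ t in s, t * gaussPdf σ t) ^ 2 / (∫ t in s, gaussPdf σ t)
      ≤ ∫ t in s, t ^ 2 * gaussPdf σ t := by
  rcases (zeroth_nonneg hσ s).eq_or_lt with h | h
  · rw [← h, div_zero]
    simpa using second_nonneg hσ s 0
  · have h1 := second_nonneg hσ s ((∫ t in s, t * gaussPdf σ t) / (∫ t in s, gaussPdf σ t))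
    rw [quad hσ] at h1
    generalize (∫ t in s, t * gaussPdf σ t) = M at *
    generalize (∫ t in s, gaussPdf σ t) = A at *
    have : M ^ 2 / A = 2 * (M / A) * M - (M / A) ^ 2 * A := by
      field_simp
      ring
    linarith

lemma cell_lower {σ : ℝ} (hσ : 0 < σ) {a b : ℝ} (hab : a < b) :
    (∫ t in Set.Ioc a b, t ^ 2 * gaussPdf σ t) - (b - a) ^ 2 * (∫ t in Set.Ioc a b, gaussPdf σ t)
      ≤ (∫ t in Set.Ioc a b, t * gaussPdf σ t) ^ 2 / (∫ t in Set.Ioc a b, gaussPdf σ t) := by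
  have hpos : 0 < ∫ t in Set.Ioc a b, gaussPdf σ t := by
    rw [← intervalIntegral.integral_of_le hab.le]
    exact intervalIntegral.intervalIntegral_pos_of_pos
      (gaussPdf_int0 hσ).intervalIntegrable (gaussPdf_pos hσ) hab
  have h1 : ∫ t in Set.Ioc a b, (t - a) ^ 2 * gaussPdf σ t
      ≤ ∫ t in Set.Ioc a b, (b - a) ^ 2 * gaussPdf σ t := by
    apply setIntegral_mono_on
    · have := (((gaussPdf_int2 hσ).sub ((gaussPdf_int1 hσ).const_mul (2 * a))).add
        ((gaussPdf_int0 hσ).const_mul (a ^ 2))).integrableOn (s := Set.Ioc a b)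
      refine this.congr (ae_of_all _ fun t => ?_)
      simp only [Pi.add_apply, Pi.sub_apply]
      ring
    · exact ((gaussPdf_int0 hσ).const_mul _).integrableOn
    · exact measurableSet_Ioc
    · intro t ht
      have := (gaussPdf_pos hσ t).le
      have h2 := ht.1
      have h3 := ht.2
      gcongr
  rw [quad hσ, integral_const_mul] at h1
  generalize (∫ t in Set.Ioc a b, t * gaussPdf σ t) = M at *
  generalize (∫ t in Set.Ioc a b, gaussPdf σ t) = A at *
  have : 2 * a * M - a ^ 2 * A ≤ M ^ 2 / A := by
    rw [le_div_iff₀ hpos]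
    nlinarith [sq_nonneg (M - a * A)]
  linarith

/-- Truncated second moment. -/
noncomputable def truncW (σ a : ℝ) : ℝ := ∫ t in Set.Iic a, t ^ 2 * gaussPdf σ t

lemma left_upper {σ : ℝ} (hσ : 0 < σ) (a : ℝ) :
    gaussPdf σ a ^ 2 / gaussCdf σ a ≤ truncW σ a / σ ^ 4 := by
  have h := cell_upper hσ (Set.Iic a)
  rw [first_Iic hσ] at h
  change _ / gaussCdf σ a ≤ truncW σ a at h
  rw [le_div_iff₀ (by positivity)]
  refine le_trans (le_of_eq ?_) h
  ring

lemma cdf_Ioi {σ : ℝ} (hσ : 0 < σ) (a : ℝ) :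
    ∫ t in Set.Ioi a, gaussPdf σ t = 1 - gaussCdf σ a := by
  rw [set_Ioi (gaussPdf_int0 hσ), gaussPdf_total0 hσ, gaussCdf]

lemma right_upper {σ : ℝ} (hσ : 0 < σ) (a : ℝ) :
    (-gaussPdf σ a) ^ 2 / (1 - gaussCdf σ a) ≤ (σ ^ 2 - truncW σ a) / σ ^ 4 := by
  have h := cell_upper hσ (Set.Ioi a)
  rw [first_Ioi hσ, cdf_Ioi hσ, set_Ioi (gaussPdf_int2 hσ), gaussPdf_total2 hσ] at h
  change _ ≤ σ ^ 2 - truncW σ a at h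
  rw [le_div_iff₀ (by positivity)]
  refine le_trans (le_of_eq ?_) h
  ring

lemma cdf_Ioc {σ : ℝ} (hσ : 0 < σ) {a b : ℝ} (hab : a ≤ b) :
    ∫ t in Set.Ioc a b, gaussPdf σ t = gaussCdf σ b - gaussCdf σ a :=
  set_Ioc (gaussPdf_int0 hσ) hab

lemma W_Ioc {σ : ℝ} (hσ : 0 < σ) {a b : ℝ} (hab : a ≤ b) :
    ∫ t in Set.Ioc a b, t ^ 2 * gaussPdf σ t = truncW σ b - truncW σ a :=
  set_Ioc (gaussPdf_int2 hσ) hab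

lemma mid_upper {σ : ℝ} (hσ : 0 < σ) {a b : ℝ} (hab : a < b) :
    (gaussPdf σ b - gaussPdf σ a) ^ 2 / (gaussCdf σ b - gaussCdf σ a)
      ≤ (truncW σ b - truncW σ a) / σ ^ 4 := by
  have h := cell_upper hσ (Set.Ioc a b)
  rw [cdf_Ioc hσ hab.le, W_Ioc hσ hab.le, set_Ioc (gaussPdf_int1 hσ) hab.le, first_Iic hσ,
    first_Iic hσ] at h
  rw [le_div_iff₀ (by positivity)]
  refine le_trans (le_of_eq ?_) h
  ring

lemma mid_lower {σ : ℝ} (hσ : 0 < σ) {a b : ℝ} (hab : a < b) :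
    ((truncW σ b - truncW σ a) - (b - a) ^ 2 * (gaussCdf σ b - gaussCdf σ a)) / σ ^ 4
      ≤ (gaussPdf σ b - gaussPdf σ a) ^ 2 / (gaussCdf σ b - gaussCdf σ a) := by
  have h := cell_lower hσ hab
  rw [cdf_Ioc hσ hab.le, W_Ioc hσ hab.le, set_Ioc (gaussPdf_int1 hσ) hab.le, first_Iic hσ,
    first_Iic hσ] at h
  rw [div_le_iff₀ (by positivity)]
  refine le_trans h (le_of_eq ?_)
  ring

lemma truncW_atTop {σ : ℝ} (hσ : 0 < σ) : Tendsto (truncW σ) atTop (nhds (σ ^ 2)) := by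
  rw [← gaussPdf_total2 hσ]
  exact (aecover_Iic tendsto_id).integral_tendsto_of_countably_generated (gaussPdf_int2 hσ)

lemma truncW_atBot {σ : ℝ} (hσ : 0 < σ) : Tendsto (truncW σ) atBot (nhds 0) := by
  have h : Tendsto (fun a => ∫ t in Set.Ioi a, t ^ 2 * gaussPdf σ t) atBot
      (nhds (∫ t, t ^ 2 * gaussPdf σ t)) :=
    (aecover_Ioi tendsto_id).integral_tendsto_of_countably_generated (gaussPdf_int2 hσ)
  have h2 := h.const_sub (∫ t, t ^ 2 * gaussPdf σ t)
  rw [sub_self] at h2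
  refine h2.congr fun a => ?_
  rw [set_Ioi (gaussPdf_int2 hσ), truncW]
  ring

lemma cdf_nonneg {σ : ℝ} (hσ : 0 < σ) (a : ℝ) : 0 ≤ gaussCdf σ a := zeroth_nonneg hσ _

lemma cdf_le_one {σ : ℝ} (hσ : 0 < σ) (a : ℝ) : gaussCdf σ a ≤ 1 := by
  have := zeroth_nonneg hσ (Set.Ioi a)
  rw [cdf_Ioi hσ] at this
  linarith

lemma cdf_mono {σ : ℝ} (hσ : 0 < σ) {a b : ℝ} (hab : a ≤ b) : gaussCdf σ a ≤ gaussCdf σ b := by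
  have := zeroth_nonneg hσ (Set.Ioc a b)
  rw [cdf_Ioc hσ hab] at this
  linarith

lemma tele (g : ℕ → ℝ) (k : ℕ) (hk : 1 ≤ k) : ∑ i ∈ Icc 2 k, (g i - g (i - 1)) = g k - g 1 := by
  induction k, hk using Nat.le_induction with
  | base => simp
  | succ k hk ih =>
    rw [Finset.sum_Icc_succ_top (by omega), ih]
    simp

lemma split_sum (σ : ℝ) (m : ℕ) (hm : 1 ≤ m) (C : ℕ → ℝ) (x : ℝ) :
    ∑ i ∈ Icc 1 (m + 1), (hfun σ m C i x) ^ 2 / Hfun σ m C i x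
      = gaussPdf σ (C 1 - x) ^ 2 / gaussCdf σ (C 1 - x)
        + (∑ i ∈ Icc 2 m, (gaussPdf σ (C i - x) - gaussPdf σ (C (i - 1) - x)) ^ 2 /
            (gaussCdf σ (C i - x) - gaussCdf σ (C (i - 1) - x)))
        + (-gaussPdf σ (C m - x)) ^ 2 / (1 - gaussCdf σ (C m - x)) := by
  rw [Finset.sum_Icc_succ_top (by omega), ← Finset.add_sum_Ioc_eq_sum_Icc hm]
  have hI : Ioc 1 m = Icc 2 m := by
    ext i
    simp only [Finset.mem_Ioc, Finset.mem_Icc]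
    omega
  rw [hI]
  congr 1
  · congr 1
    · apply Finset.sum_congr rfl
      intro i hi
      rw [Finset.mem_Icc] at hi
      have h1 : i ≠ 1 := by omega
      have h2 : i ≠ m + 1 := by omega
      simp only [hfun, Hfun, if_neg h1, if_neg h2]
  · have h1 : m + 1 ≠ 1 := by omega
    simp only [hfun, Hfun, if_neg h1, if_true]

lemma rho_upper {σ : ℝ} (hσ : 0 < σ) (m : ℕ) (hm : 1 ≤ m) (C : ℕ → ℝ)
    (hC : ∀ i, 2 ≤ i → i ≤ m → C (i - 1) < C i) (x : ℝ) :
    ∑ i ∈ Icc 1 (m + 1), (hfun σ m C i x) ^ 2 / Hfun σ m C i x ≤ 1 / σ ^ 2 := by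
  rw [split_sum σ m hm]
  have h1 := left_upper hσ (C 1 - x)
  have h2 := right_upper hσ (C m - x)
  have h3 : ∑ i ∈ Icc 2 m, (gaussPdf σ (C i - x) - gaussPdf σ (C (i - 1) - x)) ^ 2 /
            (gaussCdf σ (C i - x) - gaussCdf σ (C (i - 1) - x))
      ≤ ∑ i ∈ Icc 2 m, (truncW σ (C i - x) / σ ^ 4 - truncW σ (C (i - 1) - x) / σ ^ 4) := by
    apply Finset.sum_le_sum
    intro i hi
    rw [Finset.mem_Icc] at hi
    rw [← sub_div]
    exact mid_upper hσ (by linarith [hC i hi.1 hi.2])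
  rw [tele (fun i => truncW σ (C i - x) / σ ^ 4) m hm] at h3
  have h4 : 1 / σ ^ 2 = σ ^ 2 / σ ^ 4 := by field_simp
  rw [sub_div] at h2
  rw [h4]
  linarith

lemma rho_lower {σ : ℝ} (hσ : 0 < σ) (m : ℕ) (hm : 1 ≤ m) (C : ℕ → ℝ)
    (hC : ∀ i, 2 ≤ i → i ≤ m → C (i - 1) < C i) {δ : ℝ}
    (hδ : ∀ i, 2 ≤ i → i ≤ m → C i - C (i - 1) < δ) (x : ℝ) :
    (truncW σ (C m - x) - truncW σ (C 1 - x) - δ ^ 2) / σ ^ 4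
      ≤ ∑ i ∈ Icc 1 (m + 1), (hfun σ m C i x) ^ 2 / Hfun σ m C i x := by
  rw [split_sum σ m hm]
  have h1 : 0 ≤ gaussPdf σ (C 1 - x) ^ 2 / gaussCdf σ (C 1 - x) :=
    div_nonneg (sq_nonneg _) (cdf_nonneg hσ _)
  have h2 : 0 ≤ (-gaussPdf σ (C m - x)) ^ 2 / (1 - gaussCdf σ (C m - x)) :=
    div_nonneg (sq_nonneg _) (sub_nonneg.2 (cdf_le_one hσ _))
  let g : ℕ → ℝ := fun i => (truncW σ (C i - x) - δ ^ 2 * gaussCdf σ (C i - x)) / σ ^ 4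
  have h3 : ∑ i ∈ Icc 2 m, (g i - g (i - 1))
      ≤ ∑ i ∈ Icc 2 m, (gaussPdf σ (C i - x) - gaussPdf σ (C (i - 1) - x)) ^ 2 /
            (gaussCdf σ (C i - x) - gaussCdf σ (C (i - 1) - x)) := by
    apply Finset.sum_le_sum
    intro i hi
    rw [Finset.mem_Icc] at hi
    have hlt := hC i hi.1 hi.2
    have hd := hδ i hi.1 hi.2
    refine le_trans ?_ (mid_lower hσ (a := C (i - 1) - x) (b := C i - x) (by linarith))
    have hF := cdf_mono hσ (a := C (i - 1) - x) (b := C i - x) (by linarith)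
    have hsq : (C i - x - (C (i - 1) - x)) ^ 2 ≤ δ ^ 2 :=
      pow_le_pow_left₀ (by linarith) (by linarith) 2
    have hm' := mul_le_mul_of_nonneg_right hsq (sub_nonneg.2 hF)
    simp only [g]
    rw [← sub_div]
    apply div_le_div_of_nonneg_right _ (by positivity)
    linarith
  rw [tele g m hm] at h3
  have h4 : (truncW σ (C m - x) - truncW σ (C 1 - x) - δ ^ 2) / σ ^ 4 ≤ g m - g 1 := by
    simp only [g]
    rw [← sub_div]
    apply div_le_div_of_nonneg_right _ (by positivity)
    nlinarith [cdf_le_one hσ (C m - x), cdf_nonneg hσ (C 1 - x), sq_nonneg δ]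
  linarith

/-- as the thresholds refine (`C₁⁽ⁿ⁾ → -∞`, `C_{m_n}⁽ⁿ⁾ → +∞`, and the
maximal gap between consecutive thresholds tends to `0`), the Fisher information
`ρ⁽ⁿ⁾(x) = Σᵢ (hᵢ⁽ⁿ⁾(x))²/Hᵢ⁽ⁿ⁾(x)` converges to `1/σ²` for every `x`. -/
theorem stmt_4 {σ : ℝ} (hσ : 0 < σ)
    (m : ℕ → ℕ) (hm : ∀ n, 1 ≤ m n)
    (C : ℕ → ℕ → ℝ)
    (hC : ∀ n i j, 1 ≤ i → i < j → j ≤ m n → C n i < C n j)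
    (hC1 : Tendsto (fun n => C n 1) atTop atBot)
    (hCm : Tendsto (fun n => C n (m n)) atTop atTop)
    (hgap : ∀ ε : ℝ, 0 < ε → ∃ N : ℕ, ∀ n ≥ N, ∀ i : ℕ, 2 ≤ i → i ≤ m n →
      C n i - C n (i - 1) < ε) :
    ∀ x : ℝ,
      Tendsto (fun n => ∑ i ∈ Icc 1 (m n + 1),
          (hfun σ (m n) (C n) i x) ^ 2 / Hfun σ (m n) (C n) i x)
        atTop (nhds (1 / σ ^ 2)) := by
  intro x
  have hC' : ∀ n i, 2 ≤ i → i ≤ m n → C n (i - 1) < C n i := fun n i h1 h2 =>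
    hC n (i - 1) i (by omega) (by omega) h2
  have hW : Tendsto (fun n => truncW σ (C n (m n) - x) - truncW σ (C n 1 - x)) atTop
      (nhds (σ ^ 2 - 0)) :=
    ((truncW_atTop hσ).comp (tendsto_atTop_add_const_right _ (-x) hCm)).sub
      ((truncW_atBot hσ).comp (tendsto_atBot_add_const_right _ (-x) hC1))
  rw [sub_zero] at hW
  rw [Metric.tendsto_atTop]
  intro ε hε
  have hε4 : 0 < ε * σ ^ 4 / 2 := by positivity
  obtain ⟨N1, hN1⟩ := hgap (Real.sqrt (ε * σ ^ 4 / 2)) (Real.sqrt_pos.2 hε4)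
  obtain ⟨N2, hN2⟩ := Metric.tendsto_atTop.1 hW _ hε4
  refine ⟨max N1 N2, fun n hn => ?_⟩
  have hu := rho_upper hσ (m n) (hm n) (C n) (hC' n) x
  have hl := rho_lower hσ (m n) (hm n) (C n) (hC' n) (hN1 n (le_trans (le_max_left _ _) hn)) x
  have h2 := hN2 n (le_trans (le_max_right _ _) hn)
  rw [Real.dist_eq, abs_lt] at h2
  rw [Real.sq_sqrt hε4.le] at hl
  have h3 : 1 / σ ^ 2 - ε < (truncW σ (C n (m n) - x) - truncW σ (C n 1 - x)
      - ε * σ ^ 4 / 2) / σ ^ 4 := by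
    rw [lt_div_iff₀ (by positivity)]
    have : (1 / σ ^ 2 - ε) * σ ^ 4 = σ ^ 2 - ε * σ ^ 4 := by
      field_simp
    rw [this]
    linarith [h2.1]
  rw [Real.dist_eq, abs_lt]
  constructor <;> linarith
end

section
/- For every x ∈ ℝ: (i) each H_i(x) > 0 and β(x) := Σ_{i=1}^{m+1} h_i(x)²/H_i(x) satisfies 0 < β(x) < ∞; (ii) the numbers α_i(x) := −h_i(x)/H_i(x) are strictly increasing in i, i.e. α_1(x) < α_2(x) < ⋯ < α_{m+1}(x); (iii) α_{m+1}(x) − α_1(x) = f(C_m − x)/(1 − F(C_m − x)) + f(C_1 − x)/F(C_1 − x) > 0; consequently, for every compact set K ⊂ ℝ, inf_{x∈K} (α_{m+1}(x) − α_1(x)) > 0. -/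
set_option autoImplicit false

open MeasureTheory ProbabilityTheory Filter Finset Matrix

/-- Indicator (as a real number) of the event `Cᵢ₋₁ < y ≤ Cᵢ`, for `i = 1, …, m+1`,
with the conventions `C₀ = -∞`, `C_{m+1} = +∞`. -/
noncomputable def qInd (m : ℕ) (C : ℕ → ℝ) (i : ℕ) (y : ℝ) : ℝ :=
  if i = 1 then (if y ≤ C 1 then 1 else 0)
  else if i = m + 1 then (if C m < y then 1 else 0)
  else (if C (i - 1) < y ∧ y ≤ C i then 1 else 0)

open Topology in
lemma gaussPdf_facts {σ : ℝ} (hσ : 0 < σ) :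
    (∀ x, 0 < gaussPdf σ x) ∧
    (∀ x, HasDerivAt (gaussPdf σ) (-(x / σ ^ 2) * gaussPdf σ x) x) ∧
    (∀ x, HasDerivAt (gaussCdf σ) (gaussPdf σ x) x) ∧
    Tendsto (gaussPdf σ) atBot (𝓝 0) ∧ Tendsto (gaussPdf σ) atTop (𝓝 0) ∧
    Tendsto (gaussCdf σ) atBot (𝓝 0) ∧ Tendsto (gaussCdf σ) atTop (𝓝 1) := by
  have hpos : ∀ x, 0 < gaussPdf σ x := fun x => by unfold gaussPdf; positivity
  have hd : ∀ x, HasDerivAt (gaussPdf σ) (-(x / σ ^ 2) * gaussPdf σ x) x := by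
    intro x
    have h1 : HasDerivAt (fun x : ℝ => -(x ^ 2) / (2 * σ ^ 2)) (-(x / σ ^ 2)) x := by
      have := ((hasDerivAt_pow 2 x).neg).div_const (2 * σ ^ 2)
      refine this.congr_deriv ?_
      field_simp
      norm_num
    have h2 := (h1.exp).const_mul ((σ * Real.sqrt (2 * Real.pi))⁻¹)
    refine HasDerivAt.congr_deriv (f := gaussPdf σ) h2 ?_
    unfold gaussPdf
    ring
  have hcont : Continuous (gaussPdf σ) :=
    continuous_iff_continuousAt.2 fun x => (hd x).continuousAt
  let v : NNReal := ⟨σ ^ 2, sq_nonneg σ⟩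
  have hv : v ≠ 0 := by
    intro h
    have : σ ^ 2 = 0 := congrArg NNReal.toReal h
    have := pow_pos hσ 2
    linarith
  have heq : gaussPdf σ = gaussianPDFReal 0 v := by
    funext x
    have hs : Real.sqrt (2 * Real.pi * σ ^ 2) = σ * Real.sqrt (2 * Real.pi) := by
      rw [Real.sqrt_mul (by positivity), Real.sqrt_sq hσ.le, mul_comm]
    have hvv : (v : ℝ) = σ ^ 2 := rfl
    simp only [gaussPdf, gaussianPDFReal, hvv, hs, sub_zero]
  have hint : Integrable (gaussPdf σ) := heq ▸ integrable_gaussianPDFReal 0 v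
  have hcdf : gaussCdf σ = cdf (gaussianReal 0 v) := by
    funext x
    rw [cdf_eq_real, measureReal_def, gaussianReal_apply_eq_integral 0 hv, ← heq,
      ENNReal.toReal_ofReal]
    · rfl
    · exact integral_nonneg fun t => (hpos t).le
  have hD : ∀ x, HasDerivAt (gaussCdf σ) (gaussPdf σ x) x := by
    intro x
    have h1 := (intervalIntegral.integral_hasDerivAt_right (a := 0) (b := x)
      (hcont.intervalIntegrable 0 x) (hcont.stronglyMeasurableAtFilter _ _)
      hcont.continuousAt).add_const (gaussCdf σ 0)
    refine h1.congr_of_eventuallyEq (Eventually.of_forall fun y => ?_)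
    have := intervalIntegral.integral_Iic_sub_Iic (μ := volume) (f := gaussPdf σ)
      (a := 0) (b := y) hint.integrableOn hint.integrableOn
    simp only [gaussCdf]
    linarith
  have htop : ∀ l : Filter ℝ, Tendsto (fun x : ℝ => x ^ 2) l atTop →
      Tendsto (gaussPdf σ) l (𝓝 0) := by
    intro l hl
    have h1 : Tendsto (fun x : ℝ => -(x ^ 2) / (2 * σ ^ 2)) l atBot :=
      (tendsto_neg_atTop_atBot.comp hl).atBot_div_const (by positivity)
    have := (Real.tendsto_exp_atBot.comp h1).const_mul ((σ * Real.sqrt (2 * Real.pi))⁻¹)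
    rw [mul_zero] at this
    exact this
  refine ⟨hpos, hd, hD, htop _ ?_, htop _ (tendsto_pow_atTop two_ne_zero), ?_, ?_⟩
  · have := (tendsto_pow_atTop (α := ℝ) two_ne_zero).comp tendsto_neg_atBot_atTop
    refine this.congr fun x => ?_
    simp
  · rw [hcdf]; exact tendsto_cdf_atBot _
  · rw [hcdf]; exact tendsto_cdf_atTop _

/-- The bounds saying that the conditional mean over an interval lies in the interval. -/
lemma gauss_bounds {σ : ℝ} (hσ : 0 < σ) :
    StrictMono (gaussCdf σ) ∧ (∀ x, 0 < gaussCdf σ x) ∧ (∀ x, gaussCdf σ x < 1) ∧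
    (∀ a b, a < b → -(gaussPdf σ b - gaussPdf σ a)
      < b / σ ^ 2 * (gaussCdf σ b - gaussCdf σ a)) ∧
    (∀ a b, a < b → a / σ ^ 2 * (gaussCdf σ b - gaussCdf σ a)
      < -(gaussPdf σ b - gaussPdf σ a)) ∧
    (∀ b, -gaussPdf σ b < b / σ ^ 2 * gaussCdf σ b) ∧
    (∀ a, a / σ ^ 2 * (1 - gaussCdf σ a) < gaussPdf σ a) := by
  obtain ⟨hpos, hd, hD, hf0, hf1, hF0, hF1⟩ := gaussPdf_facts hσ
  have hs : 0 < σ ^ 2 := by positivity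
  have hmono : StrictMono (gaussCdf σ) :=
    strictMono_of_deriv_pos fun x => by rw [(hD x).deriv]; exact hpos x
  have hFpos : ∀ x, 0 < gaussCdf σ x := fun x =>
    (hmono.monotone.le_of_tendsto hF0 (x - 1)).trans_lt (hmono (by linarith))
  have hFlt : ∀ x, gaussCdf σ x < 1 := fun x =>
    (hmono (show x < x + 1 by linarith)).trans_le (hmono.monotone.ge_of_tendsto hF1 (x + 1))
  -- derivative of `y / σ² * (F y - k) + f y`
  have hder : ∀ k y, HasDerivAt (fun y => y / σ ^ 2 * (gaussCdf σ y - k) + gaussPdf σ y)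
      ((gaussCdf σ y - k) / σ ^ 2) y := by
    intro k y
    have h := (((hasDerivAt_id y).div_const (σ ^ 2)).mul ((hD y).sub_const k)).add (hd y)
    refine HasDerivAt.congr_deriv
      (f := fun y => y / σ ^ 2 * (gaussCdf σ y - k) + gaussPdf σ y) h ?_
    simp only [id]
    ring
  have hA : ∀ a b, a < b → -(gaussPdf σ b - gaussPdf σ a)
      < b / σ ^ 2 * (gaussCdf σ b - gaussCdf σ a) := by
    intro a b hab
    have h := strictMonoOn_of_deriv_pos (convex_Ici a)
      (f := fun y => y / σ ^ 2 * (gaussCdf σ y - gaussCdf σ a) + gaussPdf σ y)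
      (fun y _ => (hder _ y).continuousAt.continuousWithinAt)
      (fun y hy => by
        rw [interior_Ici] at hy
        rw [(hder _ y).deriv]
        exact div_pos (sub_pos.2 (hmono hy)) hs)
      (Set.mem_Ici.2 le_rfl) (Set.mem_Ici.2 hab.le) hab
    simp only [sub_self, mul_zero] at h
    linarith
  have hB : ∀ a b, a < b → a / σ ^ 2 * (gaussCdf σ b - gaussCdf σ a)
      < -(gaussPdf σ b - gaussPdf σ a) := by
    intro a b hab
    have h := strictAntiOn_of_deriv_neg (convex_Iic b)
      (f := fun y => y / σ ^ 2 * (gaussCdf σ y - gaussCdf σ b) + gaussPdf σ y)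
      (fun y _ => (hder _ y).continuousAt.continuousWithinAt)
      (fun y hy => by
        rw [interior_Iic] at hy
        rw [(hder _ y).deriv]
        exact div_neg_of_neg_of_pos (sub_neg.2 (hmono hy)) hs)
      (Set.mem_Iic.2 hab.le) (Set.mem_Iic.2 le_rfl) hab
    simp only [sub_self, mul_zero] at h
    linarith
  refine ⟨hmono, hFpos, hFlt, hA, hB, ?_, ?_⟩
  · have hw : ∀ b, 0 ≤ b / σ ^ 2 * (gaussCdf σ b - 0) + gaussPdf σ b := by
      intro b
      have hl := ((hF0.const_sub (gaussCdf σ b)).const_mul (b / σ ^ 2)).add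
        (hf0.const_sub (gaussPdf σ b))
      rw [sub_zero (gaussPdf σ b)] at hl
      refine ge_of_tendsto hl ?_
      filter_upwards [eventually_lt_atBot b] with a ha
      have := hA a b ha
      linarith
    intro b
    have hm := strictMono_of_deriv_pos
      (f := fun y => y / σ ^ 2 * (gaussCdf σ y - 0) + gaussPdf σ y)
      (fun y => by rw [(hder _ y).deriv]; exact div_pos (sub_pos.2 (hFpos y)) hs)
    have h := (hw (b - 1)).trans_lt (hm (show b - 1 < b by linarith))
    simp only [sub_zero] at h
    linarith
  · have hw : ∀ a, 0 ≤ a / σ ^ 2 * (gaussCdf σ a - 1) + gaussPdf σ a := by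
      intro a
      have hl := ((hF1.const_sub (gaussCdf σ a)).const_mul (a / σ ^ 2)).add
        (hf1.const_sub (gaussPdf σ a))
      rw [sub_zero (gaussPdf σ a)] at hl
      refine ge_of_tendsto hl ?_
      filter_upwards [eventually_gt_atTop a] with b hb
      have := hB a b hb
      linarith
    intro a
    have hm := strictAnti_of_deriv_neg
      (f := fun y => y / σ ^ 2 * (gaussCdf σ y - 1) + gaussPdf σ y)
      (fun y => by
        rw [(hder _ y).deriv]; exact div_neg_of_neg_of_pos (sub_neg.2 (hFlt y)) hs)
    have h := (hw (a + 1)).trans_lt (hm (show a < a + 1 by linarith))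
    simp only at h
    linarith

/-- positivity of the `Hᵢ`, positivity of `β(x) = Σ hᵢ²/Hᵢ`, strict
monotonicity of `αᵢ(x) = -hᵢ(x)/Hᵢ(x)` in `i`, the explicit value and positivity of
`α_{m+1}(x) - α₁(x)`, and positivity of its infimum over compact sets. -/
theorem stmt_6 {σ : ℝ} (hσ : 0 < σ) {m : ℕ} (hm : 1 ≤ m)
    (C : ℕ → ℝ) (hC : ∀ i j, 1 ≤ i → i < j → j ≤ m → C i < C j) :
    (∀ x : ℝ,
      ((∀ i ∈ Icc 1 (m + 1), 0 < Hfun σ m C i x) ∧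
        0 < ∑ i ∈ Icc 1 (m + 1), (hfun σ m C i x) ^ 2 / Hfun σ m C i x) ∧
      (∀ i ∈ Icc 2 (m + 1),
        -(hfun σ m C (i - 1) x) / Hfun σ m C (i - 1) x
          < -(hfun σ m C i x) / Hfun σ m C i x) ∧
      (-(hfun σ m C (m + 1) x) / Hfun σ m C (m + 1) x
          - (-(hfun σ m C 1 x) / Hfun σ m C 1 x)
        = gaussPdf σ (C m - x) / (1 - gaussCdf σ (C m - x))
          + gaussPdf σ (C 1 - x) / gaussCdf σ (C 1 - x) ∧
        0 < gaussPdf σ (C m - x) / (1 - gaussCdf σ (C m - x))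
          + gaussPdf σ (C 1 - x) / gaussCdf σ (C 1 - x))) ∧
    (∀ K : Set ℝ, IsCompact K → ∃ c > 0, ∀ x ∈ K,
      c ≤ -(hfun σ m C (m + 1) x) / Hfun σ m C (m + 1) x
          - (-(hfun σ m C 1 x) / Hfun σ m C 1 x)) := by
  obtain ⟨hpos, hd, hD, -⟩ := gaussPdf_facts hσ
  obtain ⟨hmono, hFpos, hFlt, hA, hB, hL, hU⟩ := gauss_bounds hσ
  have hstep : ∀ i, i ≠ 1 → i ≠ m + 1 → 1 ≤ i → i ≤ m + 1 → C (i - 1) < C i :=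
    fun i h1 h2 h3 h4 => hC _ _ (by omega) (by omega) (by omega)
  have hH : ∀ x, ∀ i ∈ Icc 1 (m + 1), 0 < Hfun σ m C i x := by
    intro x i hi
    rw [Finset.mem_Icc] at hi
    unfold Hfun
    split_ifs with h1 h2
    · exact hFpos _
    · exact sub_pos.2 (hFlt _)
    · exact sub_pos.2 (hmono (sub_lt_sub_right (hstep i h1 h2 hi.1 hi.2) x))
  have hup : ∀ x i, 1 ≤ i → i ≤ m →
      -(hfun σ m C i x) / Hfun σ m C i x < (C i - x) / σ ^ 2 := by
    intro x i h1 h2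
    rw [div_lt_iff₀ (hH x i (Finset.mem_Icc.2 ⟨h1, by omega⟩))]
    unfold hfun Hfun
    by_cases hi : i = 1
    · subst hi
      simpa using hL (C 1 - x)
    · rw [if_neg hi, if_neg hi, if_neg (by omega), if_neg (by omega)]
      exact hA _ _ (sub_lt_sub_right (hstep i hi (by omega) h1 (by omega)) x)
  have hlow : ∀ x i, 2 ≤ i → i ≤ m + 1 →
      (C (i - 1) - x) / σ ^ 2 < -(hfun σ m C i x) / Hfun σ m C i x := by
    intro x i h1 h2
    rw [lt_div_iff₀ (hH x i (Finset.mem_Icc.2 ⟨by omega, h2⟩))]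
    have hi1 : i ≠ 1 := by omega
    unfold hfun Hfun
    rw [if_neg hi1, if_neg hi1]
    by_cases hi : i = m + 1
    · subst hi
      simpa using hU (C m - x)
    · rw [if_neg hi, if_neg hi]
      exact hB _ _ (sub_lt_sub_right (hstep i (by omega) hi (by omega) h2) x)
  have hEq : ∀ x, -(hfun σ m C (m + 1) x) / Hfun σ m C (m + 1) x
          - (-(hfun σ m C 1 x) / Hfun σ m C 1 x)
        = gaussPdf σ (C m - x) / (1 - gaussCdf σ (C m - x))
          + gaussPdf σ (C 1 - x) / gaussCdf σ (C 1 - x) := by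
    intro x
    have hm1 : m + 1 ≠ 1 := by omega
    unfold hfun Hfun
    rw [if_neg hm1, if_neg hm1, if_pos rfl, if_pos rfl, if_pos rfl, if_pos rfl]
    ring
  have hPos : ∀ x, 0 < gaussPdf σ (C m - x) / (1 - gaussCdf σ (C m - x))
          + gaussPdf σ (C 1 - x) / gaussCdf σ (C 1 - x) := fun x =>
    add_pos (div_pos (hpos _) (sub_pos.2 (hFlt _))) (div_pos (hpos _) (hFpos _))
  refine ⟨fun x => ⟨⟨hH x, ?_⟩, ?_, hEq x, hPos x⟩, ?_⟩
  · have h1 : (1 : ℕ) ∈ Icc 1 (m + 1) := Finset.mem_Icc.2 ⟨le_rfl, by omega⟩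
    refine Finset.sum_pos' (fun i hi => div_nonneg (sq_nonneg _) (hH x i hi).le) ⟨1, h1, ?_⟩
    refine div_pos (pow_pos ?_ 2) (hH x 1 h1)
    simpa [hfun] using hpos (C 1 - x)
  · intro i hi
    rw [Finset.mem_Icc] at hi
    exact (hup x (i - 1) (by omega) (by omega)).trans (hlow x i hi.1 hi.2)
  · intro K hK
    have cf : Continuous (gaussPdf σ) :=
      continuous_iff_continuousAt.2 fun x => (hd x).continuousAt
    have cF : Continuous (gaussCdf σ) :=
      continuous_iff_continuousAt.2 fun x => (hD x).continuousAt
    have hc : Continuous fun x => gaussPdf σ (C m - x) / (1 - gaussCdf σ (C m - x))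
          + gaussPdf σ (C 1 - x) / gaussCdf σ (C 1 - x) := by
      refine Continuous.add (Continuous.div (by fun_prop) (by fun_prop) ?_)
        (Continuous.div (by fun_prop) (by fun_prop) ?_)
      · exact fun x => (sub_pos.2 (hFlt _)).ne'
      · exact fun x => (hFpos _).ne'
    rcases K.eq_empty_or_nonempty with rfl | hne
    · exact ⟨1, one_pos, fun x hx => hx.elim⟩
    · obtain ⟨x₀, -, hmin⟩ := hK.exists_isMinOn hne hc.continuousOn
      refine ⟨_, hPos x₀, fun x hx => ?_⟩
      rw [hEq x]
      exact hmin hx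
end

section
/- Let φ_k ∈ ℝⁿ satisfy sup_k ‖φ_k‖ ≤ φ̄ < ∞ and liminf_{k→∞} (1/k) Σ_{l=1}^k φ_l φ_lᵀ > 0 (positive definite), and let β_k be scalars with 0 < β̲ ≤ β_k ≤ β̄ < ∞. Starting from any positive definite matrix P₀, define a_k = (1 + β_k φ_kᵀ P_{k−1} φ_k)⁻¹ and P_k = P_{k−1} − a_k β_k P_{k−1} φ_k φ_kᵀ P_{k−1}. Then: (i) each P_k is positive definite and P_k⁻¹ = P_{k−1}⁻¹ + β_k φ_k φ_kᵀ, equivalently P_k⁻¹ = P₀⁻¹ + Σ_{i=1}^k β_i φ_i φ_iᵀ; (ii) 0 ≤ P_k ≤ P_{k−1} in the Loewner order; (iii) there is a constant c > 0 such that ‖P_k‖ ≤ c/k for all k ≥ 1, i.e. P_k = O(1/k). -/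
set_option autoImplicit false

open Matrix Finset

/-- The spectral norm (ℓ²-operator norm) of a real square matrix. -/
noncomputable def specNorm {n : ℕ} (A : Matrix (Fin n) (Fin n) ℝ) : ℝ :=
  ‖LinearMap.toContinuousLinearMap (Matrix.toEuclideanLin A)‖


lemma aux_inv {n : ℕ} (Q : Matrix (Fin n) (Fin n) ℝ) (hQ : Q.PosDef) (v : Fin n → ℝ) (b a : ℝ)
    (hb : 0 ≤ b) (ha : a = (1 + b * (v ⬝ᵥ (Q *ᵥ v)))⁻¹) :
    (Q - (a * b) • (Q * vecMulVec v v * Q)) * (Q⁻¹ + b • vecMulVec v v) = 1 := by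
  have hu : IsUnit Q.det := (Matrix.isUnit_iff_isUnit_det Q).1 hQ.isUnit
  have hs : 0 ≤ v ⬝ᵥ (Q *ᵥ v) := by
    have := hQ.posSemidef.dotProduct_mulVec_nonneg v
    simpa using this
  have h1 : a * (1 + b * (v ⬝ᵥ (Q *ᵥ v))) = 1 := by
    rw [ha]; exact inv_mul_cancel₀ (by positivity)
  have h2 : vecMulVec v v * Q * vecMulVec v v = (v ⬝ᵥ (Q *ᵥ v)) • vecMulVec v v := by
    rw [vecMulVec_mul, vecMulVec_mul_vecMulVec, dotProduct_mulVec, vecMulVec_smul]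
  have h3 : Q * Q⁻¹ = 1 := Matrix.mul_nonsing_inv Q hu
  have e : (Q - (a * b) • (Q * vecMulVec v v * Q)) * (Q⁻¹ + b • vecMulVec v v)
      = Q * Q⁻¹ + b • (Q * vecMulVec v v) - (a * b) • (Q * vecMulVec v v * (Q * Q⁻¹))
        - (a * b * b) • (Q * (vecMulVec v v * Q * vecMulVec v v)) := by
    simp only [sub_mul, mul_add, smul_mul_assoc, mul_smul_comm, smul_smul, mul_assoc, smul_sub]
    module
  rw [e, h2, h3, mul_one, mul_smul_comm, smul_smul]
  have h4 : b - a * b - a * b * b * (v ⬝ᵥ (Q *ᵥ v)) = 0 := by linear_combination (-b) * h1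
  have : (1 : Matrix (Fin n) (Fin n) ℝ) + b • (Q * vecMulVec v v) - (a * b) • (Q * vecMulVec v v)
        - (a * b * b * (v ⬝ᵥ (Q *ᵥ v))) • (Q * vecMulVec v v)
      = 1 + (b - a * b - a * b * b * (v ⬝ᵥ (Q *ᵥ v))) • (Q * vecMulVec v v) := by
    rw [sub_smul, sub_smul]; abel
  rw [this, h4, zero_smul, add_zero]

lemma aux_psd {n : ℕ} (v : Fin n → ℝ) : (vecMulVec v v).PosSemidef := by
  simpa using posSemidef_vecMulVec_self_star v

lemma aux_quad {n : ℕ} (v y : Fin n → ℝ) : y ⬝ᵥ (vecMulVec v v *ᵥ y) = (v ⬝ᵥ y) ^ 2 := by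
  rw [vecMulVec_mulVec]
  simp [dotProduct_comm y v, sq]

lemma aux_norm {n : ℕ} (P : Matrix (Fin n) (Fin n) ℝ) (hP : P.PosDef) (m : ℝ) (hm : 0 < m)
    (h : ∀ y : Fin n → ℝ, m * (y ⬝ᵥ y) ≤ y ⬝ᵥ (P⁻¹ *ᵥ y)) : specNorm P ≤ 1 / m := by
  have hu : IsUnit P.det := (Matrix.isUnit_iff_isUnit_det P).1 hP.isUnit
  refine ContinuousLinearMap.opNorm_le_bound _ (by positivity) fun x => ?_
  set y := LinearMap.toContinuousLinearMap (Matrix.toEuclideanLin P) x with hy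
  have hy' : y.ofLp = P *ᵥ x.ofLp := rfl
  have hx : P⁻¹ *ᵥ y.ofLp = x.ofLp := by
    rw [hy', mulVec_mulVec, Matrix.nonsing_inv_mul P hu, one_mulVec]
  have h1 := h y.ofLp
  rw [hx] at h1
  have h2 : y.ofLp ⬝ᵥ y.ofLp = ‖y‖ ^ 2 := by
    rw [← real_inner_self_eq_norm_sq, EuclideanSpace.inner_eq_star_dotProduct]; simp
  have h3 : y.ofLp ⬝ᵥ x.ofLp ≤ ‖x‖ * ‖y‖ := by
    have := real_inner_le_norm x y
    rw [EuclideanSpace.inner_eq_star_dotProduct] at this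
    simpa using this
  rw [h2] at h1
  rw [div_mul_eq_mul_div, one_mul, le_div_iff₀ hm]
  rcases (norm_nonneg y).eq_or_lt with h0 | h0
  · rw [← h0]; simp
  · refine le_of_mul_le_mul_right ?_ h0
    nlinarith

/-- properties of the recursion `P_k = P_{k-1} - a_k β_k P_{k-1} φ_k φ_kᵀ P_{k-1}`
under bounded persistent excitation: (i) each `P_k` is positive definite with
`P_k⁻¹ = P_{k-1}⁻¹ + β_k φ_k φ_kᵀ = P₀⁻¹ + Σ_{i=1}^k β_i φ_i φ_iᵀ`;
(ii) `0 ≤ P_k ≤ P_{k-1}` in the Loewner order; (iii) `‖P_k‖ ≤ c/k` for some `c > 0`. -/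
theorem stmt_11 {n : ℕ} (hn : 1 ≤ n)
    (φ : ℕ → Fin n → ℝ) (φbar : ℝ) (hφ : ∀ k, Real.sqrt (φ k ⬝ᵥ φ k) ≤ φbar)
    (hPE : ∃ ε : ℝ, 0 < ε ∧ ∃ K : ℕ, 1 ≤ K ∧ ∀ k ≥ K,
      Matrix.PosSemidef
        ((1 / (k : ℝ)) • ∑ l ∈ Icc 1 k, vecMulVec (φ l) (φ l)
          - ε • (1 : Matrix (Fin n) (Fin n) ℝ)))
    (β : ℕ → ℝ) (βlow βbar : ℝ) (hβlow : 0 < βlow)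
    (hβ : ∀ k, βlow ≤ β k ∧ β k ≤ βbar)
    (P0 : Matrix (Fin n) (Fin n) ℝ) (hP0 : P0.PosDef)
    (a : ℕ → ℝ) (Pm : ℕ → Matrix (Fin n) (Fin n) ℝ) (hPm0 : Pm 0 = P0)
    (ha : ∀ k : ℕ, 1 ≤ k → a k = (1 + β k * (φ k ⬝ᵥ (Pm (k - 1) *ᵥ φ k)))⁻¹)
    (hPrec : ∀ k : ℕ, 1 ≤ k →
      Pm k = Pm (k - 1)
        - (a k * β k) • (Pm (k - 1) * vecMulVec (φ k) (φ k) * Pm (k - 1))) :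
    (∀ k, (Pm k).PosDef) ∧
    (∀ k : ℕ, 1 ≤ k → (Pm k)⁻¹ = (Pm (k - 1))⁻¹ + β k • vecMulVec (φ k) (φ k)) ∧
    (∀ k : ℕ, (Pm k)⁻¹ = P0⁻¹ + ∑ i ∈ Icc 1 k, β i • vecMulVec (φ i) (φ i)) ∧
    (∀ k : ℕ, 1 ≤ k → (Pm k).PosSemidef ∧ (Pm (k - 1) - Pm k).PosSemidef) ∧
    (∃ c : ℝ, 0 < c ∧ ∀ k : ℕ, 1 ≤ k → specNorm (Pm k) ≤ c / k) := by
  have hbpos : ∀ k, 0 < β k := fun k => hβlow.trans_le (hβ k).1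
  have step : ∀ k, 1 ≤ k → (Pm (k-1)).PosDef →
      (Pm k)⁻¹ = (Pm (k - 1))⁻¹ + β k • vecMulVec (φ k) (φ k) ∧ (Pm k).PosDef := by
    intro k hk hQ
    have h := aux_inv (Pm (k-1)) hQ (φ k) (β k) (a k) (hbpos k).le (ha k hk)
    rw [← hPrec k hk] at h
    have hpd : ((Pm (k - 1))⁻¹ + β k • vecMulVec (φ k) (φ k)).PosDef :=
      hQ.inv.add_posSemidef ((aux_psd (φ k)).smul (hbpos k).le)
    refine ⟨Matrix.inv_eq_right_inv h, ?_⟩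
    rw [← Matrix.inv_eq_left_inv h]
    exact hpd.inv
  have hpd : ∀ k, (Pm k).PosDef := by
    intro k
    induction k with
    | zero => rwa [hPm0]
    | succ k ih => exact (step (k+1) (by omega) (by simpa using ih)).2
  have hsum : ∀ k : ℕ, (Pm k)⁻¹ = P0⁻¹ + ∑ i ∈ Icc 1 k, β i • vecMulVec (φ i) (φ i) := by
    intro k
    induction k with
    | zero => simp [hPm0]
    | succ k ih =>
      rw [(step (k+1) (by omega) (hpd _)).1, Nat.add_sub_cancel, ih,
        Finset.sum_Icc_succ_top (by omega), add_assoc]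
  refine ⟨hpd, fun k hk => (step k hk (hpd _)).1, hsum, fun k hk => ⟨(hpd k).posSemidef, ?_⟩, ?_⟩
  · rw [hPrec k hk, sub_sub_cancel]
    have hQ := hpd (k-1)
    have hs : 0 ≤ φ k ⬝ᵥ (Pm (k-1) *ᵥ φ k) := by
      have := hQ.posSemidef.dotProduct_mulVec_nonneg (φ k)
      simpa using this
    have hb := hbpos k
    have hab : 0 ≤ a k * β k := by rw [ha k hk]; positivity
    have := (aux_psd (φ k)).mul_mul_conjTranspose_same (Pm (k-1))
    rw [hQ.isHermitian.eq] at this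
    exact this.smul hab
  · obtain ⟨ε, hε, K, hK, hPE⟩ := hPE
    have hnn : ∀ k : ℕ, 0 ≤ (k:ℝ) * specNorm (Pm k) := fun k =>
      mul_nonneg (Nat.cast_nonneg k) (norm_nonneg _)
    have hS : 0 ≤ ∑ j ∈ range K, (j:ℝ) * specNorm (Pm j) := Finset.sum_nonneg fun j _ => hnn j
    have hd : 0 < 1 / (βlow * ε) := by positivity
    refine ⟨1 / (βlow * ε) + ∑ j ∈ range K, (j:ℝ) * specNorm (Pm j), by positivity, ?_⟩
    intro k hk
    have hk0 : (0:ℝ) < k := by exact_mod_cast hk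
    rw [le_div_iff₀ hk0]
    rcases lt_or_ge k K with hlt | hge
    · have := Finset.single_le_sum (f := fun j : ℕ => (j:ℝ) * specNorm (Pm j))
        (fun j _ => hnn j) (Finset.mem_range.2 hlt)
      linarith [mul_comm (specNorm (Pm k)) (k:ℝ)]
    · have hb : specNorm (Pm k) ≤ 1 / (βlow * ε * k) := by
        refine aux_norm _ (hpd k) _ (by positivity) fun y => ?_
        rw [hsum k, add_mulVec, dotProduct_add, sum_mulVec, dotProduct_sum]
        have h0 : 0 ≤ y ⬝ᵥ (P0⁻¹ *ᵥ y) := by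
          have := hP0.inv.posSemidef.dotProduct_mulVec_nonneg y
          simpa using this
        have h1 : βlow * ∑ i ∈ Icc 1 k, (φ i ⬝ᵥ y) ^ 2
            ≤ ∑ i ∈ Icc 1 k, y ⬝ᵥ ((β i • vecMulVec (φ i) (φ i)) *ᵥ y) := by
          rw [Finset.mul_sum]
          refine Finset.sum_le_sum fun i _ => ?_
          rw [smul_mulVec, dotProduct_smul, aux_quad, smul_eq_mul]
          exact mul_le_mul_of_nonneg_right (hβ i).1 (sq_nonneg _)
        have h2 : ε * (y ⬝ᵥ y) ≤ (1 / (k:ℝ)) * ∑ i ∈ Icc 1 k, (φ i ⬝ᵥ y) ^ 2 := by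
          have := (hPE k hge).dotProduct_mulVec_nonneg y
          simp only [star_trivial, sub_mulVec, smul_mulVec, dotProduct_sub, dotProduct_smul,
            sum_mulVec, dotProduct_sum, aux_quad, one_mulVec, smul_eq_mul] at this
          linarith
        rw [div_mul_eq_mul_div, one_mul, le_div_iff₀ hk0] at h2
        have h3 := mul_le_mul_of_nonneg_left h2 hβlow.le
        linarith
      have : specNorm (Pm k) * k ≤ 1 / (βlow * ε) := by
        calc _ ≤ 1 / (βlow * ε * k) * k := by gcongr
          _ = _ := by field_simp
      linarith
end

section
/- Let φ_l ∈ ℝⁿ and β_l > 0 for l ≥ 1, let P₀ be positive definite, and define a_l = (1 + β_l φ_lᵀ P_{l−1} φ_l)⁻¹ and P_l = P_{l−1} − a_l β_l P_{l−1} φ_l φ_lᵀ P_{l−1}. Then for every k ≥ 1: Σ_{l=1}^k a_l β_l φ_lᵀ P_{l−1} φ_l ≤ log det(P_k⁻¹) − log det(P₀⁻¹). -/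
set_option autoImplicit false

open Matrix Finset

lemma aux_step {n : ℕ} (P : Matrix (Fin n) (Fin n) ℝ) (hP : P.PosDef) (b : ℝ) (hb : 0 < b)
    (v : Fin n → ℝ) (s : ℝ) (hs : s = (1 + b * (v ⬝ᵥ (P *ᵥ v)))⁻¹)
    (Q : Matrix (Fin n) (Fin n) ℝ)
    (hQ : Q = P - (s * b) • (P * vecMulVec v v * P)) :
    Q.PosDef ∧ s * b * (v ⬝ᵥ (P *ᵥ v)) ≤ Real.log (Q⁻¹).det - Real.log (P⁻¹).det := by
  have hx : 0 ≤ v ⬝ᵥ (P *ᵥ v) := by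
    simpa using hP.posSemidef.dotProduct_mulVec_nonneg v
  have hVPV : vecMulVec v v * P * vecMulVec v v = (v ⬝ᵥ (P *ᵥ v)) • vecMulVec v v := by
    rw [Matrix.mul_assoc, mul_vecMulVec, vecMulVec_mul_vecMulVec, vecMulVec_smul]
  generalize hxd : v ⬝ᵥ (P *ᵥ v) = x at *
  have hpos : 0 < 1 + b * x := by positivity
  have hs1 : s * (1 + b * x) = 1 := by rw [hs]; exact inv_mul_cancel₀ hpos.ne'
  have hu : IsUnit P.det := hP.det_pos.ne'.isUnit
  have hR : (P⁻¹ + b • vecMulVec v v).PosDef := by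
    refine hP.inv.add_posSemidef ?_
    have := (Matrix.posSemidef_vecMulVec_self_star v).smul hb.le
    simpa using this
  have hmul : Q * (P⁻¹ + b • vecMulVec v v) = 1 := by
    have h1 : P * vecMulVec v v * P * vecMulVec v v = x • (P * vecMulVec v v) := by
      rw [Matrix.mul_assoc P, Matrix.mul_assoc P, hVPV, Matrix.mul_smul]
    rw [hQ, Matrix.sub_mul, Matrix.mul_add, Matrix.mul_add, Matrix.smul_mul, Matrix.smul_mul,
      Matrix.mul_smul, Matrix.mul_smul, h1, mul_nonsing_inv _ hu,
      mul_nonsing_inv_cancel_right _ _ hu]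
    have h2 : b - s * b - s * b * b * x = 0 := by linear_combination (-b) * hs1
    have h3 := congrArg (fun t : ℝ => (1 : Matrix (Fin n) (Fin n) ℝ) + t • (P * vecMulVec v v)) h2
    simp only [zero_smul, add_zero] at h3
    refine Eq.trans ?_ h3
    module
  have hQR : Q = (P⁻¹ + b • vecMulVec v v)⁻¹ := (Matrix.inv_eq_left_inv hmul).symm
  have hQi : Q⁻¹ = P⁻¹ + b • vecMulVec v v := Matrix.inv_eq_right_inv hmul
  refine ⟨hQR ▸ hR.inv, ?_⟩
  have hdet : (Q⁻¹).det = (P⁻¹).det * (1 + b * x) := by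
    have : P⁻¹ + b • vecMulVec v v
        = P⁻¹ * (1 + replicateCol Unit (b • (P *ᵥ v)) * replicateRow Unit v) := by
      rw [← vecMulVec_eq, smul_vecMulVec, Matrix.mul_add, Matrix.mul_one, Matrix.mul_smul,
        mul_vecMulVec, Matrix.mulVec_mulVec, nonsing_inv_mul _ hu, Matrix.one_mulVec]
    rw [hQi, this, det_mul, det_one_add_replicateCol_mul_replicateRow, dotProduct_smul, hxd,
      smul_eq_mul]
  have hPd : 0 < (P⁻¹).det := hP.inv.det_pos
  rw [hdet, Real.log_mul hPd.ne' hpos.ne']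
  have := Real.one_sub_inv_le_log_of_pos hpos
  rw [← hs] at this
  linarith

/-- for the recursion `a_l = (1 + β_l φ_lᵀ P_{l-1} φ_l)⁻¹`,
`P_l = P_{l-1} - a_l β_l P_{l-1} φ_l φ_lᵀ P_{l-1}` started from a positive definite
`P₀`, one has `Σ_{l=1}^k a_l β_l φ_lᵀ P_{l-1} φ_l ≤ log det(P_k⁻¹) - log det(P₀⁻¹)`. -/
theorem stmt_16 {n : ℕ}
    (φ : ℕ → Fin n → ℝ) (β : ℕ → ℝ) (hβ : ∀ l, 0 < β l)
    (P0 : Matrix (Fin n) (Fin n) ℝ) (hP0 : P0.PosDef)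
    (a : ℕ → ℝ) (Pm : ℕ → Matrix (Fin n) (Fin n) ℝ)
    (hPm0 : Pm 0 = P0)
    (ha : ∀ l : ℕ, 1 ≤ l → a l = (1 + β l * (φ l ⬝ᵥ (Pm (l - 1) *ᵥ φ l)))⁻¹)
    (hPrec : ∀ l : ℕ, 1 ≤ l →
      Pm l = Pm (l - 1)
        - (a l * β l) • (Pm (l - 1) * vecMulVec (φ l) (φ l) * Pm (l - 1))) :
    ∀ k : ℕ, 1 ≤ k →
      ∑ l ∈ Icc 1 k, a l * β l * (φ l ⬝ᵥ (Pm (l - 1) *ᵥ φ l))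
        ≤ Real.log ((Pm k)⁻¹).det - Real.log ((Pm 0)⁻¹).det := by
  have key : ∀ k : ℕ, (Pm k).PosDef ∧
      ∑ l ∈ Icc 1 k, a l * β l * (φ l ⬝ᵥ (Pm (l - 1) *ᵥ φ l))
        ≤ Real.log ((Pm k)⁻¹).det - Real.log ((Pm 0)⁻¹).det := by
    intro k
    induction k with
    | zero => exact ⟨hPm0 ▸ hP0, by simp⟩
    | succ k ih =>
      obtain ⟨h1, h2⟩ := aux_step (Pm k) ih.1 (β (k+1)) (hβ _) (φ (k+1)) (a (k+1))
        (ha (k+1) (by omega)) (Pm (k+1)) (hPrec (k+1) (by omega))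
      refine ⟨h1, ?_⟩
      rw [Finset.sum_Icc_succ_top (by omega), Nat.add_sub_cancel]
      linarith [ih.2]
  exact fun k _ => (key k).2
end

section
/- Let X₁, X₂, … be a bounded sequence of vectors in ℝⁿ (n ≥ 1), let A₀ be a positive definite n×n matrix, and set A_k = A₀ + Σ_{i=1}^k X_i X_iᵀ. Then Σ_{k=1}^∞ (X_kᵀ A_k⁻¹ X_k)² < ∞. -/
set_option autoImplicit false

open Matrix Finset

lemma step_aux {n : ℕ} (B : Matrix (Fin n) (Fin n) ℝ) (hB : B.PosDef) (x : Fin n → ℝ)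
    (hC : (B + vecMulVec x x).PosDef) :
    ((B + vecMulVec x x)⁻¹ *ᵥ x) ⬝ᵥ ((B + vecMulVec x x)⁻¹ *ᵥ x)
      ≤ (B⁻¹).trace - ((B + vecMulVec x x)⁻¹).trace := by
  have hBd : IsUnit B.det := (Matrix.isUnit_iff_isUnit_det _).1 hB.isUnit
  have hCd : IsUnit (B + vecMulVec x x).det := (Matrix.isUnit_iff_isUnit_det _).1 hC.isUnit
  set C := B + vecMulVec x x with hCdef
  set y := C⁻¹ *ᵥ x with hy
  set z := B⁻¹ *ᵥ x with hz
  have hv : 0 ≤ x ⬝ᵥ z := by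
    have := hB.inv.posSemidef.dotProduct_mulVec_nonneg x
    simpa using this
  have hBz : B *ᵥ z = x := by
    rw [hz, mulVec_mulVec, Matrix.mul_nonsing_inv _ hBd, one_mulVec]
  have hCz : C *ᵥ z = (1 + x ⬝ᵥ z) • x := by
    rw [hCdef, add_mulVec, hBz, vecMulVec_mulVec]
    ext i; simp; ring
  have hzy : z = (1 + x ⬝ᵥ z) • y := by
    rw [hy, ← mulVec_smul, ← hCz, mulVec_mulVec, Matrix.nonsing_inv_mul _ hCd, one_mulVec]
  have hsym : (C⁻¹)ᵀ = C⁻¹ := by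
    have := hC.inv.isHermitian.eq
    simpa [conjTranspose_eq_transpose_of_trivial] using this
  have hdiff : B⁻¹ - C⁻¹ = vecMulVec z y := by
    have h1 : B⁻¹ * (C - B) * C⁻¹ = B⁻¹ - C⁻¹ := by
      rw [Matrix.mul_sub, Matrix.nonsing_inv_mul _ hBd, Matrix.sub_mul, Matrix.mul_assoc,
        Matrix.mul_nonsing_inv _ hCd, Matrix.mul_one, Matrix.one_mul]
    rw [← h1, hCdef, add_sub_cancel_left, ← hCdef, mul_vecMulVec, vecMulVec_mul, hy,
      ← mulVec_transpose, hsym]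
  rw [← trace_sub, hdiff, trace_vecMulVec]
  have hyy : 0 ≤ y ⬝ᵥ y := by
    simpa using dotProduct_star_self_nonneg y
  have h2 : z ⬝ᵥ y = (1 + x ⬝ᵥ z) * (y ⬝ᵥ y) := by
    conv_lhs => rw [hzy]
    rw [smul_dotProduct, smul_eq_mul]
  rw [h2]
  nlinarith

/-- for a bounded sequence of vectors `Xᵢ` in `ℝⁿ` and
`A_k = A₀ + Σ_{i=1}^k Xᵢ Xᵢᵀ` with `A₀` positive definite,
`Σ_k (X_kᵀ A_k⁻¹ X_k)² < ∞`. -/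
theorem stmt_18 {n : ℕ} (hn : 1 ≤ n)
    (X : ℕ → Fin n → ℝ) (hX : ∃ c : ℝ, ∀ i, Real.sqrt (X i ⬝ᵥ X i) ≤ c)
    (A0 : Matrix (Fin n) (Fin n) ℝ) (hA0 : A0.PosDef)
    (A : ℕ → Matrix (Fin n) (Fin n) ℝ)
    (hA : ∀ k, A k = A0 + ∑ i ∈ Icc 1 k, vecMulVec (X i) (X i)) :
    Summable (fun k => (X k ⬝ᵥ ((A k)⁻¹ *ᵥ X k)) ^ 2) := by
  obtain ⟨c, hc⟩ := hX
  have hsucc : ∀ k, A (k + 1) = A k + vecMulVec (X (k + 1)) (X (k + 1)) := by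
    intro k
    rw [hA, hA, Finset.sum_Icc_succ_top (by omega), add_assoc]
  have hpos : ∀ k, (A k).PosDef := by
    intro k
    induction k with
    | zero => rw [hA]; simpa using hA0
    | succ k ih =>
      rw [hsucc]
      refine ih.add_posSemidef ?_
      simpa using posSemidef_vecMulVec_self_star (X (k + 1))
  have hXX : ∀ i, X i ⬝ᵥ X i ≤ c ^ 2 := fun i => (Real.sqrt_le_iff.1 (hc i)).2
  rw [← summable_nat_add_iff 1]
  have hterm : ∀ k, (X (k + 1) ⬝ᵥ ((A (k + 1))⁻¹ *ᵥ X (k + 1))) ^ 2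
      ≤ c ^ 2 * (((A k)⁻¹).trace - ((A (k + 1))⁻¹).trace) := by
    intro k
    have h1 := step_aux (A k) (hpos k) (X (k + 1)) (by rw [← hsucc]; exact hpos _)
    rw [← hsucc] at h1
    set y := (A (k + 1))⁻¹ *ᵥ X (k + 1)
    have hyy : 0 ≤ y ⬝ᵥ y := by
      simpa using dotProduct_star_self_nonneg y
    have hcs : (X (k + 1) ⬝ᵥ y) ^ 2 ≤ (X (k + 1) ⬝ᵥ X (k + 1)) * (y ⬝ᵥ y) := by
      have := Finset.sum_mul_sq_le_sq_mul_sq Finset.univ (X (k + 1)) y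
      simpa [dotProduct, sq] using this
    calc _ ≤ _ := hcs
      _ ≤ c ^ 2 * (y ⬝ᵥ y) := mul_le_mul_of_nonneg_right (hXX _) hyy
      _ ≤ _ := mul_le_mul_of_nonneg_left h1 (sq_nonneg c)
  refine summable_of_sum_range_le (c := c ^ 2 * ((A 0)⁻¹).trace) (fun k => sq_nonneg _) ?_
  intro m
  refine (Finset.sum_le_sum fun k _ => hterm k).trans ?_
  rw [← Finset.mul_sum, Finset.sum_range_sub' (fun k => ((A k)⁻¹).trace)]
  have : 0 ≤ ((A m)⁻¹).trace := (hpos m).inv.posSemidef.trace_nonneg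
  exact mul_le_mul_of_nonneg_left (by linarith) (sq_nonneg c)
end

section
/- Let a, b ∈ ℝ with a > 0 and fix a positive integer l₀ > a. Then: (i) there exists a constant M > 0 such that for all integers k ≥ l ≥ l₀, ∏_{i=l+1}^k (1 − a/i) ≤ M (l/k)^a; (ii) as k → ∞, Σ_{l=l₀}^k (∏_{i=l+1}^k (1 − a/i)) · l^{−(1+b)} is O(k^{−a}) if a < b, O(k^{−a} log k) if a = b, and O(k^{−b}) if a > b. -/
set_option autoImplicit false

open Finset Filter

lemma aux_prod (a : ℝ) (ha : 0 < a) (l : ℕ) (hl : a < (l : ℝ)) (k : ℕ) (hk : l ≤ k) :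
    ∏ i ∈ Icc (l + 1) k, (1 - a / (i : ℝ)) ≤ (((l : ℝ) + 1) / ((k : ℝ) + 1)) ^ a := by
  induction k, hk using Nat.le_induction with
  | base =>
    have : ((l : ℝ) + 1) ≠ 0 := by positivity
    simp [div_self this]
  | succ k hk ih =>
    rw [Finset.prod_Icc_succ_top (by omega)]
    have hk' : (l : ℝ) ≤ k := by exact_mod_cast hk
    have hkp : (0 : ℝ) < k := by linarith
    have h0 : 0 ≤ 1 - a / ((k + 1 : ℕ) : ℝ) := by
      rw [sub_nonneg, div_le_one (by positivity)]
      push_cast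
      linarith
    have h1 : 1 - a / ((k + 1 : ℕ) : ℝ) ≤ (((k : ℝ) + 1) / ((k : ℝ) + 1 + 1)) ^ a := by
      have e1 : 1 - a / ((k + 1 : ℕ) : ℝ) ≤ Real.exp (-(a / ((k + 1 : ℕ) : ℝ))) := by
        have := Real.add_one_le_exp (-(a / ((k + 1 : ℕ) : ℝ)))
        linarith
      refine e1.trans ?_
      have e2 : Real.exp (-(a / ((k + 1 : ℕ) : ℝ))) = Real.exp (-(1 / ((k : ℝ) + 1))) ^ a := by
        rw [← Real.exp_mul]
        congr 1
        push_cast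
        ring
      rw [e2]
      refine Real.rpow_le_rpow (Real.exp_pos _).le ?_ ha.le
      rw [Real.exp_neg, inv_le_comm₀ (Real.exp_pos _) (by positivity), inv_div]
      have := Real.add_one_le_exp (1 / ((k : ℝ) + 1))
      refine le_trans (le_of_eq ?_) this
      field_simp
      ring
    calc _ ≤ (((l : ℝ) + 1) / ((k : ℝ) + 1)) ^ a * (((k : ℝ) + 1) / ((k : ℝ) + 1 + 1)) ^ a :=
          mul_le_mul ih h1 h0 (by positivity)
      _ = _ := by
          rw [← Real.mul_rpow (by positivity) (by positivity)]
          congr 1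
          push_cast
          field_simp

lemma aux_prod2 (a : ℝ) (ha : 0 < a) (l : ℕ) (hl : a < (l : ℝ)) (k : ℕ) (hk : l ≤ k) :
    ∏ i ∈ Icc (l + 1) k, (1 - a / (i : ℝ)) ≤ 2 ^ a * ((l : ℝ) / (k : ℝ)) ^ a := by
  refine (aux_prod a ha l hl k hk).trans ?_
  have hl0 : (0 : ℝ) < l := by linarith
  have hl1 : (1 : ℝ) ≤ l := by exact_mod_cast (by exact_mod_cast hl0 : 0 < l)
  have hk' : (l : ℝ) ≤ k := by exact_mod_cast hk
  have hkp : (0 : ℝ) < k := by linarith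
  rw [← Real.mul_rpow (by positivity) (by positivity)]
  refine Real.rpow_le_rpow (by positivity) ?_ ha.le
  rw [← mul_div_assoc]
  exact div_le_div₀ (by positivity) (by linarith) hkp (by linarith)

lemma aux_sum (a b : ℝ) (ha : 0 < a) (l₀ : ℕ) (hl₀ : a < (l₀ : ℝ)) (k : ℕ) :
    ∑ l ∈ Icc l₀ k, (∏ i ∈ Icc (l + 1) k, (1 - a / (i : ℝ))) * (l : ℝ) ^ (-(1 + b))
      ≤ 2 ^ a * (k : ℝ) ^ (-a) * ∑ l ∈ Icc 1 k, (l : ℝ) ^ (a - b - 1) := by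
  have hl1 : 0 < l₀ := by
    have : (0 : ℝ) < l₀ := by linarith
    exact_mod_cast this
  calc _ ≤ ∑ l ∈ Icc l₀ k, 2 ^ a * (k : ℝ) ^ (-a) * (l : ℝ) ^ (a - b - 1) := by
        refine Finset.sum_le_sum fun l hl => ?_
        rw [Finset.mem_Icc] at hl
        have h1 : (l₀ : ℝ) ≤ l := by exact_mod_cast hl.1
        have hlp : (0 : ℝ) < l := by linarith
        refine (mul_le_mul_of_nonneg_right (aux_prod2 a ha l (by linarith) k hl.2)
          (by positivity)).trans (le_of_eq ?_)
        rw [Real.div_rpow (by positivity) (by positivity), Real.rpow_neg (Nat.cast_nonneg k),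
          show a - b - 1 = a + (-(1 + b)) by ring, Real.rpow_add hlp]
        ring
    _ ≤ ∑ l ∈ Icc 1 k, 2 ^ a * (k : ℝ) ^ (-a) * (l : ℝ) ^ (a - b - 1) := by
        refine Finset.sum_le_sum_of_subset_of_nonneg (Finset.Icc_subset_Icc hl1 le_rfl) ?_
        intro i _ _
        positivity
    _ = _ := by rw [Finset.mul_sum]

lemma aux_pow (s : ℝ) (hs : 0 < s) (k : ℕ) :
    ∑ l ∈ Icc 1 k, (l : ℝ) ^ (s - 1) ≤ (1 + 1 / s) * (k : ℝ) ^ s := by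
  have hsi : 0 < 1 / s := by positivity
  rcases le_total 1 s with h | h
  · rcases Nat.eq_zero_or_pos k with rfl | hk
    · simp [Real.zero_rpow hs.ne']
    have hkp : (0 : ℝ) < k := by exact_mod_cast hk
    calc _ ≤ ∑ l ∈ Icc 1 k, (k : ℝ) ^ (s - 1) := by
          refine Finset.sum_le_sum fun l hl => ?_
          rw [Finset.mem_Icc] at hl
          exact Real.rpow_le_rpow (by positivity) (by exact_mod_cast hl.2) (by linarith)
      _ = (k : ℝ) ^ s := by
          rw [Finset.sum_const, Nat.card_Icc, nsmul_eq_mul, Real.rpow_sub_one hkp.ne']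
          simp only [Nat.add_sub_cancel]
          field_simp
      _ ≤ _ := by
          have : 0 ≤ (k : ℝ) ^ s := by positivity
          nlinarith [mul_nonneg hsi.le this]
  · have key : ∑ l ∈ Icc 1 k, (l : ℝ) ^ (s - 1) ≤ (1 / s) * (k : ℝ) ^ s := by
      induction k with
      | zero => simp [Real.zero_rpow hs.ne']
      | succ k ih =>
        rw [Finset.sum_Icc_succ_top (by omega)]
        have hkp : (0 : ℝ) < (k : ℝ) + 1 := by positivity
        have hB := rpow_one_add_le_one_add_mul_self (s := -(1 / ((k : ℝ) + 1))) (p := s)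
          (by
            rw [neg_le_neg_iff, div_le_one hkp]
            have : (0 : ℝ) ≤ k := by positivity
            linarith) hs.le h
        have e : 1 + -(1 / ((k : ℝ) + 1)) = k / ((k : ℝ) + 1) := by
          field_simp
          ring
        rw [e, Real.div_rpow (by positivity) hkp.le, div_le_iff₀ (by positivity)] at hB
        push_cast
        rw [Real.rpow_sub_one hkp.ne']
        have h3 := mul_le_mul_of_nonneg_left hB hsi.le
        have e3 : 1 / s * ((1 + s * -(1 / ((k : ℝ) + 1))) * ((k : ℝ) + 1) ^ s)
            = 1 / s * ((k : ℝ) + 1) ^ s - ((k : ℝ) + 1) ^ s / ((k : ℝ) + 1) := by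
          field_simp
          ring
        linarith
    have : 0 ≤ (k : ℝ) ^ s := by positivity
    linarith

/-- with `0 < a` and an integer `l₀ > a`:
(i) `∏_{i=l+1}^k (1 - a/i) ≤ M (l/k)^a` for some `M > 0` and all `l₀ ≤ l ≤ k`;
(ii) `Σ_{l=l₀}^k (∏_{i=l+1}^k (1 - a/i)) l^{-(1+b)}` is `O(k^{-a})` if `a < b`,
`O(k^{-a} log k)` if `a = b`, and `O(k^{-b})` if `a > b`. -/
theorem stmt_19 (a b : ℝ) (ha : 0 < a) (l₀ : ℕ) (hl₀ : a < (l₀ : ℝ)) :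
    (∃ M : ℝ, 0 < M ∧ ∀ k l : ℕ, l₀ ≤ l → l ≤ k →
      ∏ i ∈ Icc (l + 1) k, (1 - a / (i : ℝ)) ≤ M * ((l : ℝ) / (k : ℝ)) ^ a) ∧
    ((a < b → ∃ c : ℝ, ∃ N : ℕ, ∀ k ≥ N,
        ∑ l ∈ Icc l₀ k, (∏ i ∈ Icc (l + 1) k, (1 - a / (i : ℝ))) * (l : ℝ) ^ (-(1 + b))
          ≤ c * (k : ℝ) ^ (-a)) ∧
      (a = b → ∃ c : ℝ, ∃ N : ℕ, ∀ k ≥ N,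
        ∑ l ∈ Icc l₀ k, (∏ i ∈ Icc (l + 1) k, (1 - a / (i : ℝ))) * (l : ℝ) ^ (-(1 + b))
          ≤ c * (k : ℝ) ^ (-a) * Real.log k) ∧
      (b < a → ∃ c : ℝ, ∃ N : ℕ, ∀ k ≥ N,
        ∑ l ∈ Icc l₀ k, (∏ i ∈ Icc (l + 1) k, (1 - a / (i : ℝ))) * (l : ℝ) ^ (-(1 + b))
          ≤ c * (k : ℝ) ^ (-b))) := by
  refine ⟨⟨2 ^ a, by positivity, fun k l h1 h2 => ?_⟩, fun hab => ?_, fun hab => ?_, fun hab => ?_⟩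
  · have h : (l₀ : ℝ) ≤ l := by exact_mod_cast h1
    exact aux_prod2 a ha l (by linarith) k h2
  · have hs : Summable fun n : ℕ => (n : ℝ) ^ (a - b - 1) :=
      Real.summable_nat_rpow.mpr (by linarith)
    refine ⟨2 ^ a * ∑' n : ℕ, (n : ℝ) ^ (a - b - 1), 0, fun k _ => ?_⟩
    refine (aux_sum a b ha l₀ hl₀ k).trans ?_
    rw [mul_right_comm]
    gcongr
    exact hs.sum_le_tsum _ (fun i _ => by positivity)
  · refine ⟨2 ^ a * 2, 3, fun k hk => ?_⟩
    refine (aux_sum a b ha l₀ hl₀ k).trans ?_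
    have hk3 : (3 : ℝ) ≤ k := by exact_mod_cast hk
    have hlog : 1 ≤ Real.log k := by
      rw [Real.le_log_iff_exp_le (by linarith)]
      linarith [Real.exp_one_lt_d9]
    have hH := harmonic_le_one_add_log k
    have e : ∑ l ∈ Icc 1 k, (l : ℝ) ^ (a - b - 1) = ((harmonic k : ℚ) : ℝ) := by
      rw [harmonic_eq_sum_Icc]
      push_cast
      refine Finset.sum_congr rfl fun l _ => ?_
      rw [hab, sub_self, zero_sub, Real.rpow_neg_one]
    rw [e]
    have hp : 0 ≤ (2 : ℝ) ^ a * (k : ℝ) ^ (-a) := by positivity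
    calc _ ≤ (2 : ℝ) ^ a * (k : ℝ) ^ (-a) * (2 * Real.log k) :=
          mul_le_mul_of_nonneg_left (by linarith) hp
      _ = _ := by ring
  · refine ⟨2 ^ a * (1 + 1 / (a - b)), 1, fun k hk => ?_⟩
    refine (aux_sum a b ha l₀ hl₀ k).trans ?_
    have hkp : (0 : ℝ) < k := by exact_mod_cast hk
    have hp : 0 ≤ (2 : ℝ) ^ a * (k : ℝ) ^ (-a) := by positivity
    refine (mul_le_mul_of_nonneg_left (aux_pow (a - b) (by linarith) k) hp).trans (le_of_eq ?_)
    rw [show -b = -a + (a - b) by ring, Real.rpow_add hkp]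
    ring
end
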